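/- arXiv:math/0411509 — 4 statements merged into one kernel-verified Lean document; each statement's English description precedes it below -/
import Mathlib

section
/- Let ⋆ be a t-norm on [0,1] and let → be its residuum. Then for all a, b ∈ [0,1], max(a, b) = min((a → b) → b, (b → a) → a); that is, the lattice join on [0,1] is definable from ⋆ and →. -/
/-- A t-norm: a continuous, commutative, associative binary operation on `[0,1]`
with `1` as identity, monotone in each argument. -/
def IsTnorm (star : ℝ → ℝ → ℝ) : Prop :=
  (∀ a ∈ Set.Icc (0:ℝ) 1, ∀ b ∈ Set.Icc (0:ℝ) 1, star a b ∈ Set.Icc (0:ℝ) 1) ∧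
  ContinuousOn (fun p : ℝ × ℝ => star p.1 p.2) (Set.Icc (0:ℝ) 1 ×ˢ Set.Icc (0:ℝ) 1) ∧
  (∀ a ∈ Set.Icc (0:ℝ) 1, ∀ b ∈ Set.Icc (0:ℝ) 1, star a b = star b a) ∧
  (∀ a ∈ Set.Icc (0:ℝ) 1, ∀ b ∈ Set.Icc (0:ℝ) 1, ∀ c ∈ Set.Icc (0:ℝ) 1,
    star (star a b) c = star a (star b c)) ∧
  (∀ a ∈ Set.Icc (0:ℝ) 1, star a 1 = a) ∧
  (∀ a ∈ Set.Icc (0:ℝ) 1, ∀ b ∈ Set.Icc (0:ℝ) 1, ∀ c ∈ Set.Icc (0:ℝ) 1,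
    a ≤ b → star c a ≤ star c b)

/-- The residuum of a t-norm: `a → b = sup {c ∈ [0,1] : c ⋆ a ≤ b}`. -/
noncomputable def residuum (star : ℝ → ℝ → ℝ) (a b : ℝ) : ℝ :=
  sSup {c | c ∈ Set.Icc (0:ℝ) 1 ∧ star c a ≤ b}


open Set

/-- The residuum satisfies its defining inequality: the supremum is attained. -/
theorem residuum_mem {star : ℝ → ℝ → ℝ} (h : IsTnorm star) {a b : ℝ}
    (ha : a ∈ Icc (0:ℝ) 1) (hb : b ∈ Icc (0:ℝ) 1) :
    residuum star a b ∈ Icc (0:ℝ) 1 ∧ star (residuum star a b) a ≤ b := by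
  obtain ⟨-, hcont, -, -, hone, hmono⟩ := h
  have h0 : (0:ℝ) ∈ Icc (0:ℝ) 1 := ⟨le_rfl, zero_le_one⟩
  have h1 : (1:ℝ) ∈ Icc (0:ℝ) 1 := ⟨zero_le_one, le_rfl⟩
  have hzero : star 0 a ≤ b := by
    have := hmono a ha 1 h1 0 h0 ha.2
    rw [hone 0 h0] at this
    exact this.trans hb.1
  have hcont' : ContinuousOn (fun c => star c a) (Icc (0:ℝ) 1) :=
    hcont.comp (f := fun c : ℝ => (c, a)) (by fun_prop) fun c hc => ⟨hc, ha⟩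
  have hclosed : IsClosed {c | c ∈ Icc (0:ℝ) 1 ∧ star c a ≤ b} :=
    hcont'.preimage_isClosed_of_isClosed isClosed_Icc isClosed_Iic
  exact hclosed.csSup_mem ⟨0, h0, hzero⟩ ⟨1, fun c hc => hc.1.2⟩

theorem le_residuum {star : ℝ → ℝ → ℝ} {a b c : ℝ} (hc : c ∈ Icc (0:ℝ) 1)
    (hle : star c a ≤ b) : c ≤ residuum star a b :=
  le_csSup ⟨1, fun _ hx => hx.1.2⟩ ⟨hc, hle⟩

theorem max_eq_min_residuum_of_le {star : ℝ → ℝ → ℝ} (h : IsTnorm star) {a b : ℝ}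
    (ha : a ∈ Icc (0:ℝ) 1) (hb : b ∈ Icc (0:ℝ) 1) (hab : a ≤ b) :
    max a b = min (residuum star (residuum star a b) b)
                  (residuum star (residuum star b a) a) := by
  have ⟨_, _, hcomm, _, hone, _⟩ := h
  have h1 : (1:ℝ) ∈ Icc (0:ℝ) 1 := ⟨zero_le_one, le_rfl⟩
  have hres : residuum star a b = 1 := by
    refine le_antisymm (residuum_mem h ha hb).1.2 (le_residuum h1 ?_)
    rwa [hcomm 1 h1 a ha, hone a ha]
  have hres_one : residuum star 1 b = b := by
    have ⟨hmem, hle⟩ := residuum_mem h h1 hb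
    rw [hone _ hmem] at hle
    exact le_antisymm hle (le_residuum hb (hone b hb).le)
  have ⟨hmem, hle⟩ := residuum_mem h hb ha
  rw [hcomm _ hmem b hb] at hle
  rw [hres, hres_one, max_eq_right hab, min_eq_left (le_residuum hb hle)]

/-- The lattice join on `[0,1]` is definable from a t-norm and its residuum:
`max a b = min ((a → b) → b) ((b → a) → a)`. -/
theorem tnorm_max_eq (star : ℝ → ℝ → ℝ) (h : IsTnorm star) :
    ∀ a ∈ Set.Icc (0:ℝ) 1, ∀ b ∈ Set.Icc (0:ℝ) 1,
      max a b = min (residuum star (residuum star a b) b)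
                    (residuum star (residuum star b a) a) := by
  intro a ha b hb
  rcases le_total a b with hab | hba
  · exact max_eq_min_residuum_of_le h ha hb hab
  · rw [max_comm, min_comm]
    exact max_eq_min_residuum_of_le h hb ha hba
end

section
/- Let p, q ∈ [0,1]^n be points with finite denominator such that den(q) divides den(p). Then there exists a McNaughton mapping S of [0,1]^n with S(p) = q. -/
/-- The unit cube `[0,1]^n` inside `Fin n → ℝ`. -/
def unitCube (n : ℕ) : Set (Fin n → ℝ) := Set.univ.pi fun _ => Set.Icc (0:ℝ) 1

/-- A McNaughton function in `n` variables: a continuous function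
`[0,1]^n → [0,1]` which, at every point of the cube, agrees with one of
finitely many affine polynomials with integer coefficients. -/
def IsMcNaughtonFn {n : ℕ} (f : (Fin n → ℝ) → ℝ) : Prop :=
  ContinuousOn f (unitCube n) ∧
  Set.MapsTo f (unitCube n) (Set.Icc (0:ℝ) 1) ∧
  ∃ (m : ℕ) (a : Fin m → Fin n → ℤ) (b : Fin m → ℤ),
    ∀ x ∈ unitCube n, ∃ j : Fin m,
      f x = (∑ i : Fin n, (a j i : ℝ) * x i) + (b j : ℝ)

/-- A McNaughton mapping of `[0,1]^n`: each coordinate is a McNaughton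
function. -/
def IsMcNaughtonMap {n : ℕ} (S : (Fin n → ℝ) → (Fin n → ℝ)) : Prop :=
  ∀ i : Fin n, IsMcNaughtonFn (fun x => S x i)

/-- A McNaughton homeomorphism of `[0,1]^n`: a McNaughton mapping which is a
bijection of the cube onto itself whose inverse is also a McNaughton mapping. -/
def IsMcNaughtonHomeo {n : ℕ} (S : (Fin n → ℝ) → (Fin n → ℝ)) : Prop :=
  IsMcNaughtonMap S ∧ ∃ T : (Fin n → ℝ) → (Fin n → ℝ), IsMcNaughtonMap T ∧
    (∀ x ∈ unitCube n, T (S x) = x) ∧ (∀ x ∈ unitCube n, S (T x) = x)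

/-- `p ∈ [0,1]^n` has `d` as a denominator: `d > 0` and `d • p ∈ ℤ^n`. -/
def IsDenom {n : ℕ} (p : Fin n → ℝ) (d : ℕ) : Prop :=
  0 < d ∧ ∀ i : Fin n, ∃ z : ℤ, (d : ℝ) * p i = (z : ℝ)

/-- The denominator of a point: the least positive integer `d` with
`d • p ∈ ℤ^n` (junk value `0` if there is none). -/
noncomputable def den {n : ℕ} (p : Fin n → ℝ) : ℕ := sInf {d | IsDenom p d}

theorem isDenom_den {n : ℕ} {p : Fin n → ℝ} (h : ∃ d, IsDenom p d) : IsDenom p (den p) :=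
  Nat.sInf_mem h

theorem IsDenom.of_dvd {n : ℕ} {p : Fin n → ℝ} {d e : ℕ} (h : IsDenom p d) (hde : d ∣ e)
    (he : 0 < e) : IsDenom p e := by
  obtain ⟨k, rfl⟩ := hde
  refine ⟨he, fun i => ?_⟩
  obtain ⟨z, hz⟩ := h.2 i
  refine ⟨k * z, ?_⟩
  push_cast
  rw [← hz]
  ring

/-- Some affine polynomial with integer coefficients takes the value `1 / den p` at `p`. -/
theorem exists_int_affine_eq_inv_den {n : ℕ} {p : Fin n → ℝ} (h : ∃ d, IsDenom p d) :
    ∃ (a : Fin n → ℤ) (b : ℤ), (∑ i, (a i : ℝ) * p i) + (b : ℝ) = (den p : ℝ)⁻¹ := by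
  obtain ⟨hd, hz⟩ := isDenom_den h
  choose z hz using hz
  have hd0 : (den p : ℝ) ≠ 0 := by exact_mod_cast hd.ne'
  let v : Option (Fin n) → ℤ := fun o => o.elim (den p : ℤ) z
  obtain ⟨g, hg⟩ := IsPrincipalIdealRing.principal (Ideal.span (Set.range v))
  have hdiv (o : Option (Fin n)) : g ∣ v o := by
    rw [← Ideal.mem_span_singleton, Ideal.span, ← hg]
    exact Ideal.subset_span ⟨o, rfl⟩
  obtain ⟨k, hk⟩ : g ∣ (den p : ℤ) := hdiv none
  have hgk : g ≠ 0 ∧ k ≠ 0 := by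
    rw [← mul_ne_zero_iff, ← hk]
    exact_mod_cast hd.ne'
  have hk_denom : IsDenom p k.natAbs := by
    refine ⟨Int.natAbs_pos.mpr hgk.2, fun i => ?_⟩
    obtain ⟨y, hy⟩ : g ∣ z i := hdiv (some i)
    have hky : (k : ℝ) * p i = y := by
      have hzi := hz i
      rw [hy, ← Int.cast_natCast, hk] at hzi
      push_cast at hzi
      exact mul_left_cancel₀ (Int.cast_ne_zero.mpr hgk.1) (by rw [← hzi]; ring)
    rw [Nat.cast_natAbs]
    rcases abs_choice k with hk' | hk' <;> rw [hk']
    · exact ⟨y, hky⟩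
    · exact ⟨-y, by push_cast; rw [← hky]; ring⟩
  have hunit : IsUnit g := by
    have hle : den p ≤ k.natAbs := Nat.sInf_le hk_denom
    have hmul : den p = g.natAbs * k.natAbs := by
      rw [← Int.natAbs_mul, ← hk, Int.natAbs_natCast]
    have hg_pos := Int.natAbs_pos.mpr hgk.1
    rw [Int.isUnit_iff_natAbs_eq]
    nlinarith [hk_denom.1]
  have hone : (1 : ℤ) ∈ Ideal.span (Set.range v) := by
    rw [hg]
    exact Ideal.mem_span_singleton.mpr hunit.dvd
  obtain ⟨c, hc⟩ := Ideal.mem_span_range_iff_exists_fun.mp hone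
  rw [Fintype.sum_option] at hc
  refine ⟨fun i => c (some i), c none, eq_inv_of_mul_eq_one_left ?_⟩
  have hc' : (c none : ℝ) * den p + ∑ i, (c (some i) : ℝ) * z i = 1 := by exact_mod_cast hc
  rw [← hc', add_mul, Finset.sum_mul, add_comm]
  congr 1
  refine Finset.sum_congr rfl fun i _ => ?_
  rw [← hz]
  ring

/-- Truncating an integer affine polynomial to `[0,1]` gives a McNaughton function. -/
theorem isMcNaughtonFn_truncate {n : ℕ} (a : Fin n → ℤ) (b : ℤ) :
    IsMcNaughtonFn fun x : Fin n → ℝ => max 0 (min 1 ((∑ i, (a i : ℝ) * x i) + (b : ℝ))) := by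
  refine ⟨by fun_prop, fun x _ => ⟨le_max_left _ _, max_le zero_le_one (min_le_left _ _)⟩,
    3, ![0, 0, a], ![0, 1, b], fun x _ => ?_⟩
  dsimp only
  rcases max_choice (0 : ℝ) (min 1 ((∑ i, (a i : ℝ) * x i) + (b : ℝ))) with h | h
  · exact ⟨0, by rw [h]; simp⟩
  · rcases min_choice (1 : ℝ) ((∑ i, (a i : ℝ) * x i) + (b : ℝ)) with h' | h'
    · exact ⟨1, by rw [h, h']; simp⟩
    · exact ⟨2, by rw [h, h']; simp⟩

/-- If `p, q ∈ [0,1]^n` have finite denominators with `den q ∣ den p`, then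
some McNaughton mapping sends `p` to `q`. -/
theorem mcnaughton_exists_map_of_den_dvd {n : ℕ} (p q : Fin n → ℝ)
    (hp : p ∈ unitCube n) (hq : q ∈ unitCube n)
    (hfp : ∃ d, IsDenom p d) (hfq : ∃ d, IsDenom q d)
    (hdvd : den q ∣ den p) :
    ∃ S : (Fin n → ℝ) → (Fin n → ℝ), IsMcNaughtonMap S ∧ S p = q := by
  obtain ⟨a, b, hab⟩ := exists_int_affine_eq_inv_den hfp
  have hd := (isDenom_den hfp).1
  choose w hw using ((isDenom_den hfq).of_dvd hdvd hd).2
  refine ⟨fun x i => max 0 (min 1 ((∑ j, ((w i * a j : ℤ) : ℝ) * x j) + ((w i * b : ℤ) : ℝ))),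
    fun i => isMcNaughtonFn_truncate (fun j => w i * a j) (w i * b), funext fun i => ?_⟩
  have hval : (∑ j, ((w i * a j : ℤ) : ℝ) * p j) + ((w i * b : ℤ) : ℝ) = q i := by
    have hd0 : (den p : ℝ) ≠ 0 := by exact_mod_cast hd.ne'
    push_cast
    simp_rw [mul_assoc]
    rw [← Finset.mul_sum, ← mul_add, hab, ← hw]
    field_simp
  have hqi := hq i (Set.mem_univ i)
  dsimp only
  rw [hval, min_eq_right hqi.2, max_eq_right hqi.1]
end

section
/- Let p ∈ [0,1]^n be a point not all of whose coordinates are rational (i.e. p does not have finite denominator). Then the orbit {S(p) : S a McNaughton mapping of [0,1]^n} is dense in [0,1]^n. -/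
theorem isMcNaughtonFn_clamp {n : ℕ} (i : Fin n) (a b : ℤ) :
    IsMcNaughtonFn fun x : Fin n → ℝ => max 0 (min 1 ((a : ℝ) * x i + b)) := by
  refine ⟨by fun_prop, fun x _ => ⟨le_max_left _ _, max_le zero_le_one (min_le_left _ _)⟩,
    3, ![0, 0, Pi.single i a], ![0, 1, b], fun x _ => ?_⟩
  have hsum : ∑ k : Fin n, ((Pi.single i a : Fin n → ℤ) k : ℝ) * x k = a * x i := by
    rw [Finset.sum_eq_single i (fun k _ hk => by simp [hk]) (by simp)]
    simp
  rcases max_choice 0 (min 1 ((a : ℝ) * x i + b)) with h | h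
  · exact ⟨0, by simp [h]⟩
  rcases min_choice 1 ((a : ℝ) * x i + b) with h' | h'
  · exact ⟨1, by simp [h']⟩
  · refine ⟨2, ?_⟩
    simp only [Matrix.cons_val, hsum]
    exact h.trans h'

theorem exists_irrational_coord {n : ℕ} {p : Fin n → ℝ} (h : ¬ ∃ d, IsDenom p d) :
    ∃ i, Irrational (p i) := by
  contrapose! h
  simp only [Irrational, not_not, Set.mem_range] at h
  choose r hr using h
  refine ⟨∏ i, (r i).den, Finset.prod_pos fun i _ => (r i).den_pos, fun i => ?_⟩
  obtain ⟨c, hc⟩ := Finset.dvd_prod_of_mem (fun i => (r i).den) (Finset.mem_univ i)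
  refine ⟨c * (r i).num, ?_⟩
  have key : ((r i).den : ℝ) * (r i : ℝ) = (r i).num := by exact_mod_cast (r i).den_mul_eq_num
  rw [hc, ← hr i]
  push_cast
  rw [← key]
  ring

theorem exists_int_mul_add_int_abs_sub_lt {α : ℝ} (hα : Irrational α) (t : ℝ) {ε : ℝ}
    (hε : 0 < ε) : ∃ a b : ℤ, |(a : ℝ) * α + b - t| < ε := by
  have hd : Dense (AddSubgroup.closure {α, (1 : ℝ)} : Set ℝ) :=
    dense_addSubgroupClosure_pair_iff.2 (by simpa using hα)
  obtain ⟨y, hy, hyt⟩ := hd.exists_dist_lt t hε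
  obtain ⟨a, b, rfl⟩ := AddSubgroup.mem_closure_pair.1 hy
  refine ⟨a, b, ?_⟩
  rw [dist_comm, Real.dist_eq] at hyt
  simpa using hyt

theorem abs_clamp_sub_le {t : ℝ} (ht : t ∈ Set.Icc (0 : ℝ) 1) (y : ℝ) :
    |max 0 (min 1 y) - t| ≤ |y - t| := by
  obtain ⟨h0, h1⟩ := ht
  have h := abs_max_sub_max_le_abs (min 1 y) t 0
  have h' := abs_min_sub_min_le_max 1 y 1 t
  rw [max_comm _ 0, max_eq_left h0] at h
  simp only [sub_self, abs_zero, min_eq_right h1, abs_nonneg, sup_of_le_right] at h'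
  exact h.trans h'

/-- If `p ∈ [0,1]^n` does not have finite denominator, then its orbit under the
monoid of McNaughton mappings is dense in `[0,1]^n`. -/
theorem mcnaughton_orbit_dense {n : ℕ} (p : Fin n → ℝ) (hp : p ∈ unitCube n)
    (hnotfin : ¬ ∃ d, IsDenom p d) :
    unitCube n ⊆
      closure {q | ∃ S : (Fin n → ℝ) → (Fin n → ℝ), IsMcNaughtonMap S ∧ S p = q} := by
  intro q hq
  obtain ⟨i, hi⟩ := exists_irrational_coord hnotfin
  refine Metric.mem_closure_iff.2 fun ε hε => ?_
  choose a b hab using fun j => exists_int_mul_add_int_abs_sub_lt hi (q j) hε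
  refine ⟨_, ⟨fun x j => max 0 (min 1 ((a j : ℝ) * x i + b j)),
    fun j => isMcNaughtonFn_clamp i (a j) (b j), rfl⟩, (dist_pi_lt_iff hε).2 fun j => ?_⟩
  rw [dist_comm, Real.dist_eq]
  exact (abs_clamp_sub_le (hq j (Set.mem_univ j)) _).trans_lt (hab j)
end

section
/- Let S be a McNaughton homeomorphism of [0,1]^n. Suppose U and V are nonempty open subsets of the interior of [0,1]^n on which S coincides with the affine maps x ↦ A x + b and x ↦ A' x + b' respectively, where A, A' are n × n integer matrices and b, b' integer vectors. Then det A = det A', and this common determinant is either +1 or −1. -/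
/-- The affine function with coefficient vector `φ.1` and constant term `φ.2`. -/
def affineForm {n : ℕ} (φ : (Fin n → ℝ) × ℝ) (x : Fin n → ℝ) : ℝ := φ.1 ⬝ᵥ x + φ.2

/-- `S` agrees on `C` with the integer affine map `x ↦ A x + b`. -/
def IsIntAffineOn {n : ℕ} (S : (Fin n → ℝ) → (Fin n → ℝ)) (A : Matrix (Fin n) (Fin n) ℤ)
    (b : Fin n → ℤ) (C : Set (Fin n → ℝ)) : Prop :=
  ∀ x ∈ C, S x = (A.map (Int.cast : ℤ → ℝ)).mulVec x + fun i => (b i : ℝ)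

/-- Near `x`, `S` is an integer affine map whose linear part has determinant `d`. -/
def HasLocalDet {n : ℕ} (S : (Fin n → ℝ) → (Fin n → ℝ)) (x : Fin n → ℝ) (d : ℤ) : Prop :=
  ∃ C : Set (Fin n → ℝ), IsOpen C ∧ x ∈ C ∧ ∃ A b, IsIntAffineOn S A b C ∧ A.det = d

section

variable {n : ℕ}

theorem continuous_affineForm (φ : (Fin n → ℝ) × ℝ) : Continuous (affineForm φ) := by
  unfold affineForm dotProduct
  fun_prop

theorem affineForm_add (φ : (Fin n → ℝ) × ℝ) (x y : Fin n → ℝ) :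
    affineForm φ (x + y) = affineForm φ x + φ.1 ⬝ᵥ y := by
  simp only [affineForm, dotProduct_add]
  ring

theorem affineForm_smul (r : ℝ) (φ : (Fin n → ℝ) × ℝ) (x : Fin n → ℝ) :
    affineForm (r • φ) x = r * affineForm φ x := by
  simp only [affineForm, Prod.smul_fst, Prod.smul_snd, smul_dotProduct, smul_eq_mul]
  ring

theorem affineForm_sub (φ ψ : (Fin n → ℝ) × ℝ) (x : Fin n → ℝ) :
    affineForm (φ - ψ) x = affineForm φ x - affineForm ψ x := by
  simp only [affineForm, Prod.fst_sub, Prod.snd_sub, sub_dotProduct]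
  ring

theorem affineForm_add_smul (φ : (Fin n → ℝ) × ℝ) (x y : Fin n → ℝ) (t : ℝ) :
    affineForm φ (x + t • (y - x)) = (1 - t) * affineForm φ x + t * affineForm φ y := by
  simp only [affineForm, dotProduct_add, dotProduct_smul, dotProduct_sub, smul_eq_mul]
  ring

theorem convex_affineForm_pos (φ : (Fin n → ℝ) × ℝ) : Convex ℝ {x | 0 < affineForm φ x} := by
  refine convex_iff_add_mem.2 fun x hx y hy s t hs ht hst => ?_
  have hx' : 0 < affineForm φ x := hx
  have hy' : 0 < affineForm φ y := hy
  have hst' : s = 1 - t := by linarith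
  have h : s • x + t • y = x + t • (y - x) := by
    rw [hst']
    module
  change 0 < affineForm φ (s • x + t • y)
  rw [h, affineForm_add_smul, ← hst']
  rcases hs.lt_or_eq with h | h
  · have := mul_pos h hx'
    have := mul_nonneg ht hy'.le
    linarith
  · have : t = 1 := by linarith
    rw [← h, this]
    linarith

/-- Points of an open set remain in it under small displacements. -/
theorem exists_pos_add_smul_mem {U : Set (Fin n → ℝ)} (hU : IsOpen U) {x : Fin n → ℝ}
    (hx : x ∈ U) (v : Fin n → ℝ) : ∀ᶠ t : ℝ in nhdsWithin 0 (Set.Ioi 0), x + t • v ∈ U := by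
  have hc : Continuous fun t : ℝ => x + t • v := by fun_prop
  have := hc.continuousAt.eventually_mem (x := 0) (s := U) (by simpa using hU.mem_nhds hx)
  exact this.filter_mono nhdsWithin_le_nhds

theorem eq_zero_of_affineForm_eq_zero {φ : (Fin n → ℝ) × ℝ} {U : Set (Fin n → ℝ)}
    (hU : IsOpen U) (hne : U.Nonempty) (h : ∀ x ∈ U, affineForm φ x = 0) : φ = 0 := by
  obtain ⟨x, hx⟩ := hne
  obtain ⟨t, ht, ht0⟩ := ((exists_pos_add_smul_mem hU hx φ.1).and self_mem_nhdsWithin).exists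
  have h1 := h _ ht
  have ht0' : (0 : ℝ) < t := ht0
  rw [affineForm_add, h x hx, zero_add, dotProduct_smul, smul_eq_mul] at h1
  have h2 : φ.1 = 0 := dotProduct_self_eq_zero.1 ((mul_eq_zero.1 h1).resolve_left ht0'.ne')
  have h3 := h x hx
  rw [affineForm, h2, zero_dotProduct, zero_add] at h3
  exact Prod.ext h2 h3

/-- A nonempty open set is not covered by finitely many hyperplanes. -/
theorem exists_mem_forall_affineForm_ne_zero (Φ : Finset ((Fin n → ℝ) × ℝ))
    (hΦ : ∀ φ ∈ Φ, φ ≠ 0) {V : Set (Fin n → ℝ)} (hV : IsOpen V) (hne : V.Nonempty) :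
    ∃ v ∈ V, ∀ φ ∈ Φ, affineForm φ v ≠ 0 := by
  classical
  induction Φ using Finset.induction_on generalizing V with
  | empty => exact ⟨_, hne.some_mem, by simp⟩
  | insert φ Φ _ ih =>
    have hopen : IsOpen (V ∩ {x | affineForm φ x ≠ 0}) :=
      hV.inter (isOpen_ne_fun (continuous_affineForm φ) continuous_const)
    have hne' : (V ∩ {x | affineForm φ x ≠ 0}).Nonempty := by
      by_contra hcon
      refine hΦ φ (by simp) (eq_zero_of_affineForm_eq_zero hV hne fun x hx => ?_)
      by_contra h0
      exact hcon ⟨x, hx, h0⟩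
    obtain ⟨v, hv, hv'⟩ := ih (fun ψ hψ => hΦ ψ (by simp [hψ])) hopen hne'
    exact ⟨v, hv.1, (Finset.forall_mem_insert _ _ _).2 ⟨hv.2, hv'⟩⟩

/-- Away from finitely many hyperplanes, a McNaughton function is affine on connected sets. -/
theorem IsMcNaughtonFn.exists_forms {f : (Fin n → ℝ) → ℝ} (hf : IsMcNaughtonFn f) :
    ∃ Φ : Finset ((Fin n → ℝ) × ℝ), (∀ φ ∈ Φ, φ ≠ 0) ∧
      ∀ C ⊆ unitCube n, IsPreconnected C → (∀ x ∈ C, ∀ φ ∈ Φ, affineForm φ x ≠ 0) →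
        ∃ (a : Fin n → ℤ) (b : ℤ), ∀ x ∈ C, f x = (fun i => (a i : ℝ)) ⬝ᵥ x + (b : ℝ) := by
  classical
  obtain ⟨hcont, -, m, a, b, hab⟩ := hf
  let F : Fin m → (Fin n → ℝ) × ℝ := fun j => (fun i => (a j i : ℝ), (b j : ℝ))
  have hF : ∀ x ∈ unitCube n, ∃ j, f x = affineForm (F j) x := hab
  refine ⟨(Finset.univ.image fun p : Fin m × Fin m => F p.1 - F p.2).filter (· ≠ 0),
    fun φ hφ => (Finset.mem_filter.1 hφ).2, fun C hC hconn hgood => ?_⟩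
  rcases C.eq_empty_or_nonempty with rfl | ⟨x₀, hx₀⟩
  · exact ⟨0, 0, by simp⟩
  obtain ⟨j, hj⟩ := hF x₀ (hC hx₀)
  refine ⟨a j, b j, ?_⟩
  have : PreconnectedSpace C := isPreconnected_iff_preconnectedSpace.1 hconn
  have hfC : Continuous fun x : C => f x := (hcont.mono hC).domRestrict
  have hclosed (k : Fin m) : IsClosed {x : C | f x = affineForm (F k) x} :=
    isClosed_eq hfC ((continuous_affineForm _).comp continuous_subtype_val)
  have hcompl : {x : C | f x = affineForm (F j) x}ᶜ =
      ⋃ k ∈ {k | F k ≠ F j}, {x : C | f x = affineForm (F k) x} := by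
    ext x
    simp only [Set.mem_compl_iff, Set.mem_ofPred_eq, Set.mem_iUnion, exists_prop]
    constructor
    · intro h
      obtain ⟨k, hk⟩ := hF x (hC x.2)
      exact ⟨k, fun hkj => h (by rw [hk, hkj]), hk⟩
    · rintro ⟨k, hkj, hk⟩ h
      refine hgood x x.2 (F k - F j) ?_ ?_
      · exact Finset.mem_filter.2 ⟨Finset.mem_image.2 ⟨(k, j), Finset.mem_univ _, rfl⟩,
          sub_ne_zero.2 hkj⟩
      · rw [affineForm_sub, ← hk, ← h, sub_self]
  have hclopen : IsClopen {x : C | f x = affineForm (F j) x} := by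
    refine ⟨hclosed j, isClosed_compl_iff.1 ?_⟩
    rw [hcompl]
    exact (Set.toFinite _).isClosed_biUnion fun k _ => hclosed k
  have huniv := hclopen.eq_univ ⟨⟨x₀, hx₀⟩, hj⟩
  intro x hx
  have : (⟨x, hx⟩ : C) ∈ {x : C | f x = affineForm (F j) x} := huniv ▸ Set.mem_univ _
  exact this

/-- Away from finitely many hyperplanes, a McNaughton mapping is affine on connected sets. -/
theorem IsMcNaughtonMap.exists_forms {S : (Fin n → ℝ) → (Fin n → ℝ)} (hS : IsMcNaughtonMap S) :
    ∃ Φ : Finset ((Fin n → ℝ) × ℝ), (∀ φ ∈ Φ, φ ≠ 0) ∧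
      ∀ C ⊆ unitCube n, IsPreconnected C → (∀ x ∈ C, ∀ φ ∈ Φ, affineForm φ x ≠ 0) →
        ∃ A b, IsIntAffineOn S A b C := by
  classical
  choose Φ hΦ hΦ' using fun i => (hS i).exists_forms
  refine ⟨Finset.univ.biUnion Φ, ?_, fun C hC hconn hgood => ?_⟩
  · intro φ hφ
    obtain ⟨i, -, hi⟩ := Finset.mem_biUnion.1 hφ
    exact hΦ i φ hi
  · choose A b hAb using fun i => hΦ' i C hC hconn fun x hx φ hφ =>
      hgood x hx φ (Finset.mem_biUnion.2 ⟨i, Finset.mem_univ i, hφ⟩)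
    exact ⟨Matrix.of A, b, fun x hx => funext fun i => hAb i x hx⟩

theorem IsMcNaughtonMap.continuousOn {S : (Fin n → ℝ) → (Fin n → ℝ)} (hS : IsMcNaughtonMap S) :
    ContinuousOn S (unitCube n) :=
  continuousOn_pi.2 fun i => (hS i).1

theorem IsMcNaughtonMap.mapsTo {S : (Fin n → ℝ) → (Fin n → ℝ)} (hS : IsMcNaughtonMap S) :
    Set.MapsTo S (unitCube n) (unitCube n) :=
  fun _ hx i _ => (hS i).2.1 hx

theorem IsMcNaughtonHomeo.injOn {S : (Fin n → ℝ) → (Fin n → ℝ)} (hS : IsMcNaughtonHomeo S) :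
    Set.InjOn S (unitCube n) := by
  obtain ⟨-, T, -, hTS, -⟩ := hS
  intro x hx y hy hxy
  rw [← hTS x hx, hxy, hTS y hy]

theorem matrix_eq_of_eqOn {M N : Matrix (Fin n) (Fin n) ℝ} {c d : Fin n → ℝ}
    {U : Set (Fin n → ℝ)} (hU : IsOpen U) (hne : U.Nonempty)
    (h : ∀ x ∈ U, M.mulVec x + c = N.mulVec x + d) : M = N := by
  funext i
  have key : ((M i, c i) : (Fin n → ℝ) × ℝ) - (N i, d i) = 0 := by
    refine eq_zero_of_affineForm_eq_zero hU hne fun x hx => ?_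
    rw [affineForm_sub, sub_eq_zero]
    exact congrFun (h x hx) i
  exact congrArg Prod.fst (sub_eq_zero.1 key)

theorem map_intCast_det (A : Matrix (Fin n) (Fin n) ℤ) :
    (A.map (Int.cast : ℤ → ℝ)).det = (A.det : ℝ) :=
  ((Int.castRingHom ℝ).map_det A).symm

/-- On any open set where a McNaughton homeomorphism is integer affine, its linear part is
unimodular. -/
theorem IsMcNaughtonHomeo.det_eq_one_or {S : (Fin n → ℝ) → (Fin n → ℝ)}
    (hS : IsMcNaughtonHomeo S) {U : Set (Fin n → ℝ)} (hU : IsOpen U) (hne : U.Nonempty)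
    (hsub : U ⊆ unitCube n) {A : Matrix (Fin n) (Fin n) ℤ} {b : Fin n → ℤ}
    (hA : IsIntAffineOn S A b U) : A.det = 1 ∨ A.det = -1 := by
  have hinj := hS.injOn
  obtain ⟨hSm, T, hT, hTS, hST⟩ := hS
  set M := A.map (Int.cast : ℤ → ℝ) with hM
  have hdet : M.det ≠ 0 := by
    intro h0
    obtain ⟨v, hv, hMv⟩ := Matrix.exists_mulVec_eq_zero_iff.2 h0
    obtain ⟨x, hx⟩ := hne
    obtain ⟨t, ht, ht0⟩ := ((exists_pos_add_smul_mem hU hx v).and self_mem_nhdsWithin).exists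
    have ht0' : (0 : ℝ) < t := ht0
    have heq : S (x + t • v) = S x := by
      rw [hA _ ht, hA _ hx, Matrix.mulVec_add, Matrix.mulVec_smul, hMv, smul_zero, add_zero]
    have h1 := hinj (hsub ht) (hsub hx) heq
    have h2 : t • v = 0 := by simpa using h1
    exact hv ((smul_eq_zero.1 h2).resolve_left ht0'.ne')
  have hunit : IsUnit M.det := isUnit_iff_ne_zero.2 hdet
  let c : Fin n → ℝ := fun i => (b i : ℝ)
  let g : (Fin n → ℝ) → (Fin n → ℝ) := fun y => M⁻¹.mulVec (y - c)
  have hg : Continuous g :=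
    Continuous.matrix_mulVec continuous_const (continuous_id.sub continuous_const)
  have hgS : ∀ y, M.mulVec (g y) + c = y := fun y => by
    simp [g, Matrix.mulVec_mulVec, Matrix.mul_nonsing_inv _ hunit]
  have hSg : ∀ x, g (M.mulVec x + c) = x := fun x => by
    simp [g, Matrix.mulVec_mulVec, Matrix.nonsing_inv_mul _ hunit]
  have hopen : IsOpen (g ⁻¹' U) := hU.preimage hg
  have hne' : (g ⁻¹' U).Nonempty := by
    obtain ⟨x, hx⟩ := hne
    exact ⟨M.mulVec x + c, by simpa [hSg] using hx⟩
  have hSgy : ∀ y ∈ g ⁻¹' U, S (g y) = y := fun y hy => by rw [hA _ hy]; exact hgS y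
  have hcube : g ⁻¹' U ⊆ unitCube n := fun y hy => hSgy y hy ▸ hSm.mapsTo (hsub hy)
  obtain ⟨Φ, hΦ, hΦ'⟩ := hT.exists_forms
  obtain ⟨y, hy, hyΦ⟩ := exists_mem_forall_affineForm_ne_zero Φ hΦ hopen hne'
  have hev : ∀ᶠ z in nhds y, z ∈ g ⁻¹' U ∧ ∀ φ ∈ Φ, affineForm φ z ≠ 0 := by
    refine (hopen.eventually_mem hy).and ((Filter.eventually_all_finset Φ).2 fun φ hφ => ?_)
    exact (continuous_affineForm φ).continuousAt.eventually_ne (hyΦ φ hφ)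
  obtain ⟨ε, hε, hball⟩ := Metric.eventually_nhds_iff_ball.1 hev
  obtain ⟨B, d, hB⟩ := hΦ' (Metric.ball y ε) (fun z hz => hcube (hball z hz).1)
    (convex_ball y ε).isPreconnected fun z hz => (hball z hz).2
  have hmat : M⁻¹ = B.map (Int.cast : ℤ → ℝ) := by
    refine matrix_eq_of_eqOn (c := -M⁻¹.mulVec c) (d := fun i => (d i : ℝ)) Metric.isOpen_ball
      ⟨y, Metric.mem_ball_self hε⟩ fun z hz => ?_
    have hz1 := (hball z hz).1
    rw [← hB z hz, ← sub_eq_add_neg, ← Matrix.mulVec_sub]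
    have := hTS (g z) (hsub hz1)
    rw [hSgy z hz1] at this
    exact this.symm
  have hprod : A.det * B.det = 1 := by
    have : (A.det : ℝ) * B.det = 1 := by
      rw [← map_intCast_det, ← map_intCast_det, ← hmat, ← Matrix.det_mul,
        Matrix.mul_nonsing_inv _ hunit, Matrix.det_one]
    exact_mod_cast this
  exact Int.isUnit_iff.1 (IsUnit.of_mul_eq_one _ hprod)

theorem eq_of_eventually_eq_add_smul {S g : (Fin n → ℝ) → (Fin n → ℝ)} {x : Fin n → ℝ}
    (hS : ContinuousAt S x) (hg : Continuous g) (v : Fin n → ℝ)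
    (h : ∀ᶠ t : ℝ in nhdsWithin 0 (Set.Ioi 0), S (x + t • v) = g (x + t • v)) : S x = g x := by
  have hc : Filter.Tendsto (fun t : ℝ => x + t • v) (nhdsWithin 0 (Set.Ioi 0)) (nhds x) := by
    have : Continuous fun t : ℝ => x + t • v := by fun_prop
    have := this.tendsto 0
    rw [zero_smul, add_zero] at this
    exact this.mono_left nhdsWithin_le_nhds
  exact tendsto_nhds_unique ((hS.tendsto.comp hc).congr' h) (hg.continuousAt.tendsto.comp hc)

/-- A map which is affine on either side of a hyperplane and injective does not fold: the
determinants of its linear parts do not have opposite signs. -/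
theorem det_eq_of_injOn_of_affine_sides {S : (Fin n → ℝ) → (Fin n → ℝ)}
    {W : Set (Fin n → ℝ)} (hW : IsOpen W) (hinj : Set.InjOn S W)
    (hcont : ∀ x ∈ W, ContinuousAt S x) {φ : (Fin n → ℝ) × ℝ} (hφ : φ ≠ 0)
    {p : Fin n → ℝ} (hp : p ∈ W) (hφp : affineForm φ p = 0)
    {M N : Matrix (Fin n) (Fin n) ℝ} {c d : Fin n → ℝ}
    (hM : ∀ x ∈ W, 0 < affineForm φ x → S x = M.mulVec x + c)
    (hN : ∀ x ∈ W, affineForm φ x < 0 → S x = N.mulVec x + d)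
    (hM0 : M.det ≠ 0) : 0 ≤ N.det / M.det := by
  set a := φ.1 with ha
  have ha0 : a ≠ 0 := by
    intro h
    rw [affineForm, ← ha, h, zero_dotProduct, zero_add] at hφp
    exact hφ (Prod.ext h hφp)
  have haa : 0 < a ⬝ᵥ a :=
    lt_of_le_of_ne (Finset.sum_nonneg fun i _ => mul_self_nonneg _)
      (Ne.symm fun h => ha0 (dotProduct_self_eq_zero.1 h))
  have hagree : ∀ x ∈ W, affineForm φ x = 0 → S x = M.mulVec x + c ∧ S x = N.mulVec x + d := by
    intro x hx hx0
    refine ⟨eq_of_eventually_eq_add_smul (hcont x hx) (g := fun x => M.mulVec x + c)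
      ((Continuous.matrix_mulVec continuous_const continuous_id).add continuous_const) a ?_,
      eq_of_eventually_eq_add_smul (hcont x hx) (g := fun x => N.mulVec x + d)
      ((Continuous.matrix_mulVec continuous_const continuous_id).add continuous_const) (-a) ?_⟩
    · filter_upwards [exists_pos_add_smul_mem hW hx a, self_mem_nhdsWithin] with t ht ht0
      refine hM _ ht ?_
      rw [affineForm_add, hx0, zero_add, dotProduct_smul, smul_eq_mul]
      exact mul_pos ht0 haa
    · filter_upwards [exists_pos_add_smul_mem hW hx (-a), self_mem_nhdsWithin] with t ht ht0
      refine hN _ ht ?_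
      rw [affineForm_add, hx0, zero_add, dotProduct_smul, smul_eq_mul, dotProduct_neg, mul_neg]
      exact neg_neg_of_pos (mul_pos ht0 haa)
  obtain ⟨hpM, hpN⟩ := hagree p hp hφp
  have htangent : ∀ h, a ⬝ᵥ h = 0 → N.mulVec h = M.mulVec h := by
    intro h hh
    obtain ⟨t, ht, ht0⟩ := ((exists_pos_add_smul_mem hW hp h).and self_mem_nhdsWithin).exists
    have ht0' : (0 : ℝ) < t := ht0
    obtain ⟨h1, h2⟩ := hagree _ ht (by
      rw [affineForm_add, hφp, dotProduct_smul, ← ha, hh, smul_zero, add_zero])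
    rw [Matrix.mulVec_add, Matrix.mulVec_smul, add_right_comm] at h1 h2
    rw [← hpM] at h1
    rw [← hpN] at h2
    exact smul_right_injective _ ht0'.ne' (add_left_cancel (h2.symm.trans h1))
  have hunit : IsUnit M.det := isUnit_iff_ne_zero.2 hM0
  set q : Fin n → ℝ := (a ⬝ᵥ a)⁻¹ • M⁻¹.mulVec (N.mulVec a - M.mulVec a) with hq
  have hMq : M.mulVec q = (a ⬝ᵥ a)⁻¹ • (N.mulVec a - M.mulVec a) := by
    rw [hq, Matrix.mulVec_smul, Matrix.mulVec_mulVec, Matrix.mul_nonsing_inv _ hunit,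
      Matrix.one_mulVec]
  have hNx : ∀ x, N.mulVec x = M.mulVec (x + (a ⬝ᵥ x) • q) := by
    intro x
    have h := htangent (x - ((a ⬝ᵥ x) * (a ⬝ᵥ a)⁻¹) • a) (by
      rw [dotProduct_sub, dotProduct_smul, smul_eq_mul]
      field_simp
      ring)
    rw [Matrix.mulVec_sub, Matrix.mulVec_sub, Matrix.mulVec_smul, Matrix.mulVec_smul,
      sub_eq_iff_eq_add] at h
    rw [h, Matrix.mulVec_add, Matrix.mulVec_smul, hMq]
    module
  have hdet : N.det = M.det * (1 + a ⬝ᵥ q) := by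
    have hNM : N = M * (1 + Matrix.replicateCol Unit q * Matrix.replicateRow Unit a) := by
      refine Matrix.ext_of_mulVec_single fun i => ?_
      rw [hNx, ← Matrix.mulVec_mulVec, Matrix.add_mulVec, Matrix.one_mulVec]
      congr 2
      ext k
      simp [Matrix.mul_apply, mul_comm]
    rw [hNM, Matrix.det_mul, Matrix.det_one_add_replicateCol_mul_replicateRow]
  rw [hdet, mul_div_cancel_left₀ _ hM0]
  by_contra! hlt
  set y : Fin n → ℝ := -a + (a ⬝ᵥ -a) • q with hy
  obtain ⟨t, ⟨ht1, ht2⟩, ht0⟩ := (((exists_pos_add_smul_mem hW hp (-a)).and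
    (exists_pos_add_smul_mem hW hp y)).and self_mem_nhdsWithin).exists
  have ht0' : (0 : ℝ) < t := ht0
  have hneg : affineForm φ (p + t • -a) < 0 := by
    rw [affineForm_add, hφp, zero_add, dotProduct_smul, smul_eq_mul, dotProduct_neg, mul_neg]
    exact neg_neg_of_pos (mul_pos ht0' haa)
  have hay : 0 < a ⬝ᵥ y := by
    rw [hy, dotProduct_add, dotProduct_smul, dotProduct_neg, smul_eq_mul]
    nlinarith
  have hpos : 0 < affineForm φ (p + t • y) := by
    rw [affineForm_add, hφp, zero_add, dotProduct_smul, smul_eq_mul]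
    exact mul_pos ht0' hay
  have heq : S (p + t • -a) = S (p + t • y) := by
    rw [hN _ ht1 hneg, hM _ ht2 hpos, Matrix.mulVec_add, Matrix.mulVec_add, add_right_comm,
      add_right_comm (M.mulVec p), ← hpM, ← hpN, Matrix.mulVec_smul, Matrix.mulVec_smul, hNx]
  have := hinj ht1 ht2 heq
  rw [this] at hneg
  exact lt_asymm hneg hpos

theorem HasLocalDet.unique {S : (Fin n → ℝ) → (Fin n → ℝ)} {x : Fin n → ℝ} {d e : ℤ}
    (hd : HasLocalDet S x d) (he : HasLocalDet S x e) : d = e := by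
  obtain ⟨C, hC, hxC, A, b, hA, rfl⟩ := hd
  obtain ⟨C', hC', hxC', A', b', hA', rfl⟩ := he
  have h := matrix_eq_of_eqOn (hC.inter hC') ⟨x, hxC, hxC'⟩
    fun y hy => (hA y hy.1).symm.trans (hA' y hy.2)
  rw [Matrix.map_injective Int.cast_injective h]

/-- Near a point lying on at most one hyperplane, the determinant does not change. -/
theorem IsMcNaughtonHomeo.exists_eventually_hasLocalDet {S : (Fin n → ℝ) → (Fin n → ℝ)}
    (hS : IsMcNaughtonHomeo S) {Φ : Finset ((Fin n → ℝ) × ℝ)} (hΦ : ∀ φ ∈ Φ, φ ≠ 0)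
    (hΦS : ∀ C ⊆ unitCube n, IsPreconnected C → (∀ x ∈ C, ∀ φ ∈ Φ, affineForm φ x ≠ 0) →
        ∃ A b, IsIntAffineOn S A b C)
    {p : Fin n → ℝ} (hp : p ∈ interior (unitCube n))
    (hprop : ∀ φ ∈ Φ, ∀ ψ ∈ Φ, affineForm φ p = 0 → affineForm ψ p = 0 →
      ∃ r : ℝ, r ≠ 0 ∧ ψ = r • φ) :
    ∃ c, ∀ᶠ y in nhds p, (∀ φ ∈ Φ, affineForm φ y ≠ 0) → HasLocalDet S y c := by
  have hev : ∀ᶠ y in nhds p, y ∈ interior (unitCube n) ∧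
      ∀ φ ∈ Φ, affineForm φ p ≠ 0 → affineForm φ y ≠ 0 := by
    refine (isOpen_interior.eventually_mem hp).and ((Filter.eventually_all_finset Φ).2 fun φ _ => ?_)
    by_cases h : affineForm φ p = 0
    · simp [h]
    · exact ((continuous_affineForm φ).continuousAt.eventually_ne h).mono fun y hy _ => hy
  obtain ⟨ε, hε, hball⟩ := Metric.eventually_nhds_iff_ball.1 hev
  set W := Metric.ball p ε with hWdef
  have hW : IsOpen W := Metric.isOpen_ball
  have hpW : p ∈ W := Metric.mem_ball_self hε
  have hWcube : W ⊆ unitCube n := fun y hy => interior_subset (hball y hy).1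
  by_cases hex : ∃ φ ∈ Φ, affineForm φ p = 0
  swap
  · push Not at hex
    obtain ⟨A, b, hA⟩ := hΦS W hWcube (convex_ball p ε).isPreconnected
      fun x hx φ hφ => (hball x hx).2 φ hφ (hex φ hφ)
    exact ⟨A.det, (hW.eventually_mem hpW).mono fun y hy _ => ⟨W, hW, hy, A, b, hA, rfl⟩⟩
  obtain ⟨φ, hφ, hφp⟩ := hex
  have hgood : ∀ x ∈ W, affineForm φ x ≠ 0 → ∀ ψ ∈ Φ, affineForm ψ x ≠ 0 := by
    intro x hx hx0 ψ hψ
    by_cases h : affineForm ψ p = 0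
    · obtain ⟨r, hr, rfl⟩ := hprop φ hφ ψ hψ hφp h
      rw [affineForm_smul]
      exact mul_ne_zero hr hx0
    · exact (hball x hx).2 ψ hψ h
  have hside : ∀ s : ℝ, s ≠ 0 → IsOpen (W ∩ {x | 0 < affineForm (s • φ) x}) ∧
      (W ∩ {x | 0 < affineForm (s • φ) x}).Nonempty ∧
      ∃ A b, IsIntAffineOn S A b (W ∩ {x | 0 < affineForm (s • φ) x}) := by
    intro s hs
    refine ⟨hW.inter (isOpen_lt continuous_const (continuous_affineForm _)), ?_, ?_⟩
    · by_contra hcon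
      have hzero : ∀ x ∈ W, affineForm (s • φ) x ≤ 0 := fun x hx => by
        by_contra! h
        exact hcon ⟨x, hx, h⟩
      have hz : s • φ = 0 := by
        refine eq_zero_of_affineForm_eq_zero hW ⟨p, hpW⟩ fun x hx => le_antisymm (hzero x hx) ?_
        have hx' : p + (p - x) ∈ W := by
          rw [hWdef, Metric.mem_ball, dist_eq_norm, add_sub_cancel_left, ← dist_eq_norm, dist_comm]
          exact hx
        have h1 := hzero _ hx'
        have h2 : affineForm (s • φ) p = 0 := by rw [affineForm_smul, hφp, mul_zero]
        have h3 := affineForm_add (s • φ) x (p - x)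
        rw [add_sub_cancel, h2] at h3
        rw [affineForm_add, h2] at h1
        linarith
      exact (smul_ne_zero hs (hΦ φ hφ)) hz
    · refine hΦS _ (fun x hx => hWcube hx.1)
        ((convex_ball p ε).inter (convex_affineForm_pos _)).isPreconnected fun x hx => hgood x hx.1 ?_
      intro h0
      have := hx.2
      rw [Set.mem_ofPred_eq, affineForm_smul, h0, mul_zero] at this
      exact lt_irrefl _ this
  obtain ⟨ho1, hne1, A, b, hA⟩ := hside 1 one_ne_zero
  obtain ⟨ho2, hne2, B, d, hB⟩ := hside (-1) (by norm_num)
  have hdA := hS.det_eq_one_or ho1 hne1 (fun x hx => hWcube hx.1) hA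
  have hdB := hS.det_eq_one_or ho2 hne2 (fun x hx => hWcube hx.1) hB
  have hmem1 : ∀ x ∈ W, 0 < affineForm φ x → x ∈ W ∩ {x | 0 < affineForm ((1 : ℝ) • φ) x} :=
    fun x hx h => ⟨hx, by simpa using h⟩
  have hmem2 : ∀ x ∈ W, affineForm φ x < 0 → x ∈ W ∩ {x | 0 < affineForm ((-1 : ℝ) • φ) x} :=
    fun x hx h => ⟨hx, by
      rw [Set.mem_ofPred_eq, affineForm_smul]
      linarith⟩
  have hsign := det_eq_of_injOn_of_affine_sides hW (hS.injOn.mono hWcube)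
    (fun x hx => hS.1.continuousOn.continuousAt (mem_interior_iff_mem_nhds.1 (hball x hx).1))
    (hΦ φ hφ) hpW hφp (fun x hx h => hA x (hmem1 x hx h)) (fun x hx h => hB x (hmem2 x hx h))
    (by
      rw [map_intCast_det]
      rcases hdA with h | h <;> simp [h])
  have hAB : B.det = A.det := by
    rw [map_intCast_det, map_intCast_det] at hsign
    rcases hdA with h | h <;> rcases hdB with h' | h' <;> rw [h, h'] at hsign ⊢ <;>
      norm_num at hsign
  refine ⟨A.det, (hW.eventually_mem hpW).mono fun y hy hyΦ => ?_⟩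
  rcases (hyΦ φ hφ).lt_or_gt with h | h
  · exact ⟨_, ho2, hmem2 y hy h, B, d, hB, hAB⟩
  · exact ⟨_, ho1, hmem1 y hy h, A, b, hA, rfl⟩

end

/-- On any two nonempty open pieces of the interior of the cube where a
McNaughton homeomorphism is affine with integer coefficients, the determinants
of the linear parts coincide, and they are `+1` or `-1`. -/
theorem mcnaughton_homeo_det {n : ℕ} (S : (Fin n → ℝ) → (Fin n → ℝ))
    (hS : IsMcNaughtonHomeo S)
    (U V : Set (Fin n → ℝ)) (hUopen : IsOpen U) (hVopen : IsOpen V)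
    (hUne : U.Nonempty) (hVne : V.Nonempty)
    (hUsub : U ⊆ interior (unitCube n)) (hVsub : V ⊆ interior (unitCube n))
    (A A' : Matrix (Fin n) (Fin n) ℤ) (b b' : Fin n → ℤ)
    (hA : ∀ x ∈ U, S x = fun i => (∑ j : Fin n, (A i j : ℝ) * x j) + (b i : ℝ))
    (hA' : ∀ x ∈ V, S x = fun i => (∑ j : Fin n, (A' i j : ℝ) * x j) + (b' i : ℝ)) :
    A.det = A'.det ∧ (A.det = 1 ∨ A.det = -1) := by
  classical
  refine ⟨?_, hS.det_eq_one_or hUopen hUne (hUsub.trans interior_subset) hA⟩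
  obtain ⟨Φ, hΦ, hΦS⟩ := hS.1.exists_forms
  obtain ⟨u, huU, huΦ⟩ := exists_mem_forall_affineForm_ne_zero Φ hΦ hUopen hUne
  let Ψ : Finset ((Fin n → ℝ) × ℝ) := ((Φ ×ˢ Φ).image fun q =>
    affineForm q.1 u • q.2 - affineForm q.2 u • q.1).filter (· ≠ 0)
  obtain ⟨v, hvV, hvΨ⟩ := exists_mem_forall_affineForm_ne_zero Ψ
    (fun φ hφ => (Finset.mem_filter.1 hφ).2) hVopen hVne
  have hconv : Convex ℝ (interior (unitCube n)) :=
    (convex_pi fun _ _ => convex_Icc (0 : ℝ) 1).interior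
  have hseg := hconv.segment_subset (hUsub huU) (hVsub hvV)
  let W : ℤ → Set (Fin n → ℝ) := fun c =>
    {x | ∀ᶠ y in nhds x, (∀ φ ∈ Φ, affineForm φ y ≠ 0) → HasLocalDet S y c}
  have hWopen : ∀ c, IsOpen (W c) := fun c => isOpen_setOfPred_eventually_nhds
  have hWdisj : ∀ c d x, x ∈ W c → x ∈ W d → c = d := by
    intro c d x hc hd
    obtain ⟨C, hC, hCopen, hxC⟩ := eventually_nhds_iff.1 (hc.and hd)
    obtain ⟨y, hyC, hyΦ⟩ := exists_mem_forall_affineForm_ne_zero Φ hΦ hCopen ⟨x, hxC⟩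
    exact ((hC y hyC).1 hyΦ).unique ((hC y hyC).2 hyΦ)
  have hcover : ∀ p ∈ segment ℝ u v, ∃ c, p ∈ W c := by
    intro p hp
    refine hS.exists_eventually_hasLocalDet hΦ hΦS (hseg hp) fun φ hφ ψ hψ hφp hψp => ?_
    rw [segment_eq_image'] at hp
    obtain ⟨t, -, rfl⟩ := hp
    rw [affineForm_add_smul] at hφp hψp
    have hzero : affineForm φ u • ψ - affineForm ψ u • φ = 0 := by
      by_contra hne
      refine hvΨ _ (Finset.mem_filter.2 ⟨Finset.mem_image.2
        ⟨(φ, ψ), Finset.mk_mem_product hφ hψ, rfl⟩, hne⟩) ?_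
      have ht : t ≠ 0 := by
        rintro rfl
        exact huΦ φ hφ (by linarith)
      refine (mul_eq_zero.1 ?_).resolve_left ht
      rw [affineForm_sub, affineForm_smul, affineForm_smul]
      linear_combination affineForm φ u * hψp - affineForm ψ u * hφp
    refine ⟨(affineForm φ u)⁻¹ * affineForm ψ u, mul_ne_zero (inv_ne_zero (huΦ φ hφ)) (huΦ ψ hψ), ?_⟩
    rw [mul_smul, ← sub_eq_zero.1 hzero, inv_smul_smul₀ (huΦ φ hφ)]
  have huW : u ∈ W A.det :=
    (hUopen.eventually_mem huU).mono fun y hy _ => ⟨U, hUopen, hy, A, b, hA, rfl⟩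
  have hvW : v ∈ W A'.det :=
    (hVopen.eventually_mem hvV).mono fun y hy _ => ⟨V, hVopen, hy, A', b', hA', rfl⟩
  have hsub : segment ℝ u v ⊆ W A.det := by
    refine (convex_segment u v).isPreconnected.subset_left_of_subset_union (hWopen _)
      (isOpen_biUnion fun c (_ : c ∈ {c | c ≠ A.det}) => hWopen c) ?_ ?_
      ⟨u, left_mem_segment ℝ u v, huW⟩
    · rw [Set.disjoint_left]
      intro x hx hx'
      obtain ⟨c, hc, hxc⟩ := Set.mem_iUnion₂.1 hx'
      exact hc (hWdisj _ _ x hxc hx)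
    · intro x hx
      obtain ⟨c, hc⟩ := hcover x hx
      by_cases h : c = A.det
      · exact Or.inl (h ▸ hc)
      · exact Or.inr (Set.mem_iUnion₂.2 ⟨c, h, hc⟩)
  exact hWdisj _ _ v (hsub (right_mem_segment ℝ u v)) hvW
end
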